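/- Let n > 0 with n ≠ 1. Then there is no real-analytic function f, positive on a neighbourhood of 0, with f(0) = 1, f'(0) = 0, f''(0) ≠ 0 and f'''(0) = 0, that satisfies on that neighbourhood both the similarity equation −(f^n f''')'(y) + (1/(n+4)) (y f(y))' = 0 and the consistency condition f(y)^{n/2} (f^{n/2})'''(y) = −n f(y)^{n−1} f'''(y) + y/(n+4). (This is the key step showing that for n ≠ 1 the linearised thin-film operator admits no symmetric realisation in a weighted L² space.) -/

import Mathlib

lemma tf_deriv_congr {U : Set ℝ} (hU : IsOpen U) {F G : ℝ → ℝ} (h : ∀ y ∈ U, F y = G y)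
    {y : ℝ} (hy : y ∈ U) : deriv F y = deriv G y :=
  Filter.EventuallyEq.deriv_eq (Filter.eventuallyEq_of_mem (hU.mem_nhds hy) h)

/-- A function vanishing on an open set has vanishing derivative there. -/
lemma tf_zero {U : Set ℝ} (hU : IsOpen U) {F G : ℝ → ℝ} (h : ∀ y ∈ U, F y = 0)
    (hd : ∀ y ∈ U, HasDerivAt F (G y) y) : ∀ y ∈ U, G y = 0 := by
  intro y hy
  rw [← (hd y hy).deriv, tf_deriv_congr hU (G := fun _ => 0) h hy]
  simp

/-- Taylor comparison at `0`. -/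
lemma tf_taylor {U : Set ℝ} (hU : IsOpen U) (h0 : (0 : ℝ) ∈ U)
    (f g h P Q W V : ℝ → ℝ) (A B C s β v : ℝ)
    (hf : ∀ y ∈ U, HasDerivAt f (g y) y)
    (hg : ∀ y ∈ U, HasDerivAt g (h y) y)
    (hh : ∀ y ∈ U, HasDerivAt h (β * y * W y) y)
    (hP : ∀ y ∈ U, HasDerivAt P (s * g y * Q y) y)
    (hQ : ∀ y ∈ U, HasDerivAt Q ((s - 1) * g y * W y) y)
    (hW : ∀ y ∈ U, HasDerivAt W ((s - 2) * g y * V y) y)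
    (hV : HasDerivAt V v 0)
    (f0 : f 0 = 1) (g0 : g 0 = 0) (P0 : P 0 = 1) (Q0 : Q 0 = 1) (W0 : W 0 = 1)
    (hG : ∀ y ∈ U, A * y * P y + B * (f y * g y * h y) + C * (g y) ^ 3 = 0) :
    A + B * (h 0) ^ 2 = 0 ∧
    3 * A * s * h 0 + B * (3 * (h 0) ^ 3 + 4 * h 0 * β) + 6 * C * (h 0) ^ 3 = 0 := by
  have G1 : ∀ y ∈ U, A * P y + A * s * (y * g y * Q y) + B * (g y ^ 2 * h y + f y * h y ^ 2
      + β * (f y * g y * y * W y)) + 3 * C * (g y ^ 2 * h y) = 0 := by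
    refine tf_zero hU hG fun y hy => ?_
    have := ((((hasDerivAt_id y).const_mul A).mul (hP y hy)).add
      ((((hf y hy).mul (hg y hy)).mul (hh y hy)).const_mul B)).add
      (((hg y hy).pow 3).const_mul C)
    refine HasDerivAt.congr_deriv this ?_
    simp
    ring
  have G2 : ∀ y ∈ U, A * (s * g y * Q y) + A * s * (g y * Q y + y * h y * Q y
      + y * g y * ((s - 1) * g y * W y)) + B * (3 * (g y * h y ^ 2) + 2 * β * (g y ^ 2 * y * W y)
      + 3 * β * (f y * h y * y * W y) + β * (f y * g y * W y)
      + β * (s - 2) * (f y * g y ^ 2 * y * V y))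
      + 3 * C * (2 * (g y * h y ^ 2) + β * (g y ^ 2 * y * W y)) = 0 := by
    refine tf_zero hU G1 fun y hy => ?_
    have i := hasDerivAt_id y
    have := ((((hP y hy).const_mul A).add
      (((i.mul (hg y hy)).mul (hQ y hy)).const_mul (A * s))).add
      ((((((hg y hy).pow 2).mul (hh y hy)).add ((hf y hy).mul ((hh y hy).pow 2))).add
        (((((hf y hy).mul (hg y hy)).mul i).mul (hW y hy)).const_mul β)).const_mul B)).add
      ((((hg y hy).pow 2).mul (hh y hy)).const_mul (3 * C))
    refine HasDerivAt.congr_deriv this ?_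
    simp
    ring
  have e1 := G1 0 h0
  rw [f0, g0, P0] at e1
  refine ⟨by linarith, ?_⟩
  have i := hasDerivAt_id (0 : ℝ)
  have hf := hf 0 h0
  have hg := hg 0 h0
  have hh := hh 0 h0
  have hQ := hQ 0 h0
  have hW := hW 0 h0
  have D := (((((hg.const_mul s).mul hQ).const_mul A).add
      ((((hg.mul hQ).add ((i.mul hh).mul hQ)).add
        ((i.mul hg).mul ((hg.const_mul (s - 1)).mul hW))).const_mul (A * s))).add
      ((((((((hg.mul (hh.pow 2)).const_mul 3).add
        ((((hg.pow 2).mul i).mul hW).const_mul (2 * β))).add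
        ((((hf.mul hh).mul i).mul hW).const_mul (3 * β))).add
        (((hf.mul hg).mul hW).const_mul β)).add
        ((((hf.mul (hg.pow 2)).mul i).mul hV).const_mul (β * (s - 2))))).const_mul B)).add
      ((((hg.mul (hh.pow 2)).const_mul 2).add
        ((((hg.pow 2).mul i).mul hW).const_mul β)).const_mul (3 * C))
  have E := D.deriv
  have Z := tf_deriv_congr hU (G := fun _ => 0) G2 h0
  rw [deriv_const] at Z
  have E2 := E.symm.trans Z
  simp [f0, g0, Q0, W0] at E2
  linarith

/-- For `n ≠ 1` there is no real-analytic, locally positive similarity profile `f` with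
the stated normalisation that satisfies both the similarity equation
`-(f^n f''')' + (1/(n+4))(yf)' = 0` and the self-adjointness consistency condition
`f^{n/2}(f^{n/2})''' = -n f^{n-1} f''' + y/(n+4)` near `0`. -/
theorem no_symmetric_realisation_for_n_ne_one (n : ℝ) (hn : 0 < n) (hn1 : n ≠ 1) :
    ¬ ∃ (f : ℝ → ℝ) (ε : ℝ), 0 < ε ∧
      AnalyticOnNhd ℝ f (Set.Ioo (-ε) ε) ∧
      (∀ y ∈ Set.Ioo (-ε) ε, 0 < f y) ∧
      f 0 = 1 ∧ deriv f 0 = 0 ∧ deriv (deriv f) 0 ≠ 0 ∧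
      deriv (deriv (deriv f)) 0 = 0 ∧
      (∀ y ∈ Set.Ioo (-ε) ε,
        -(deriv (fun z => f z ^ n * deriv (deriv (deriv f)) z) y)
          + (1 / (n + 4)) * deriv (fun z => z * f z) y = 0) ∧
      (∀ y ∈ Set.Ioo (-ε) ε,
        f y ^ (n / 2) * deriv (deriv (deriv (fun z => f z ^ (n / 2)))) y
          = -n * f y ^ (n - 1) * deriv (deriv (deriv f)) y + y / (n + 4)) := by
  rintro ⟨f, ε, hε, han, hpos, f0, f1, f2, f3, h1, h2⟩
  set U := Set.Ioo (-ε) ε with hUdef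
  have hU : IsOpen U := isOpen_Ioo
  have h0 : (0 : ℝ) ∈ U := ⟨by linarith, hε⟩
  set g := deriv f with hgdef
  set h := deriv g with hhdef
  set k := deriv h with hkdef
  have ang : AnalyticOnNhd ℝ g U := han.deriv
  have anh : AnalyticOnNhd ℝ h U := ang.deriv
  have ank : AnalyticOnNhd ℝ k U := anh.deriv
  have df : ∀ y ∈ U, HasDerivAt f (g y) y := fun y hy => (han y hy).differentiableAt.hasDerivAt
  have dg : ∀ y ∈ U, HasDerivAt g (h y) y := fun y hy => (ang y hy).differentiableAt.hasDerivAt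
  have dh : ∀ y ∈ U, HasDerivAt h (k y) y := fun y hy => (anh y hy).differentiableAt.hasDerivAt
  have dk : ∀ y ∈ U, HasDerivAt k (deriv k y) y :=
    fun y hy => (ank y hy).differentiableAt.hasDerivAt
  have dpow : ∀ r : ℝ, ∀ y ∈ U, HasDerivAt (fun z => f z ^ r) (r * g y * f y ^ (r - 1)) y := by
    intro r y hy
    convert (df y hy).rpow_const (p := r) (Or.inl (hpos y hy).ne') using 1
    ring
  obtain ⟨β, hβ⟩ : ∃ β : ℝ, β = 1 / (n + 4) := ⟨_, rfl⟩
  have βpos : 0 < β := by rw [hβ]; positivity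
  -- integrate the similarity equation once
  have hint : ∀ y ∈ U, f y ^ n * k y - β * (y * f y) = 0 := by
    have hd : ∀ y ∈ U, HasDerivAt (fun z => f z ^ n * k z - β * (z * f z)) 0 y := by
      intro y hy
      have a1 := (dpow n y hy).mul (dk y hy)
      have a2 := (hasDerivAt_id y).mul (df y hy)
      have a3 := a1.sub (a2.const_mul β)
      have e := h1 y hy
      have b1 := a1.deriv
      have b2 := a2.deriv
      refine HasDerivAt.congr_deriv a3 ?_
      have b1' : deriv (fun z => f z ^ n * k z) y = _ := b1
      have b2' : deriv (fun z => z * f z) y = _ := b2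
      rw [b1', b2', ← hβ] at e
      linarith
    intro y hy
    have := hU.is_const_of_deriv_eq_zero (isPreconnected_Ioo)
      (fun z hz => (hd z hz).differentiableAt.differentiableWithinAt)
      (fun z hz => (hd z hz).deriv) hy h0
    simp only [f3] at this
    rw [this]; simp
  have hk : ∀ y ∈ U, k y = β * y * f y ^ (1 - n) := by
    intro y hy
    have e := hint y hy
    have p := hpos y hy
    have q : 0 < f y ^ n := Real.rpow_pos_of_pos p n
    rw [Real.rpow_sub p, Real.rpow_one]
    field_simp
    linarith
  obtain ⟨m, hm⟩ : ∃ m : ℝ, m = n / 2 := ⟨_, rfl⟩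
  have hnm : n = 2 * m := by linarith
  -- third derivative of f^m
  have d1 : ∀ y ∈ U, deriv (fun z => f z ^ m) y = m * g y * f y ^ (m - 1) :=
    fun y hy => (dpow m y hy).deriv
  have d2 : ∀ y ∈ U, deriv (deriv (fun z => f z ^ m)) y
      = m * h y * f y ^ (m - 1) + m * g y * ((m - 1) * g y * f y ^ (m - 1 - 1)) := by
    intro y hy
    rw [tf_deriv_congr hU d1 hy]
    exact (((dg y hy).const_mul m).mul (dpow (m - 1) y hy)).deriv
  have d3 : ∀ y ∈ U, deriv (deriv (deriv (fun z => f z ^ m))) y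
      = m * k y * f y ^ (m - 1) + 3 * m * (m - 1) * g y * h y * f y ^ (m - 1 - 1)
        + m * (m - 1) * (m - 2) * g y ^ 3 * f y ^ (m - 1 - 1 - 1) := by
    intro y hy
    rw [tf_deriv_congr hU d2 hy]
    have t := ((((dh y hy).const_mul m).mul (dpow (m - 1) y hy)).add
      (((dg y hy).const_mul m).mul
        (((dg y hy).const_mul (m - 1)).mul (dpow (m - 1 - 1) y hy)))).deriv
    refine Eq.trans t ?_
    simp
    ring
  have hG : ∀ y ∈ U, ((3 * m - 1) * β) * y * f y ^ (3 - n)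
      + (3 * m * (m - 1)) * (f y * g y * h y) + (m * (m - 1) * (m - 2)) * (g y) ^ 3 = 0 := by
    intro y hy
    have e := h2 y hy
    have p := hpos y hy
    have q : 0 < f y ^ m := Real.rpow_pos_of_pos p m
    have hy4 : y / (n + 4) = β * y := by rw [hβ]; ring
    rw [← hm, d3 y hy, hk y hy, hy4] at e
    have r2 : f y ^ n = f y ^ m * f y ^ m := by rw [← Real.rpow_add p]; congr 1; linarith
    have r3 : f y ^ (3 - n) = f y ^ 3 / (f y ^ m * f y ^ m) := by
      rw [Real.rpow_sub p, r2]; norm_cast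
    simp only [Real.rpow_sub p, Real.rpow_one, r2] at e
    rw [r3]
    field_simp at e ⊢
    rw [hnm] at e
    linear_combination e
  have key := tf_taylor hU h0 f g h (fun z => f z ^ (3 - n)) (fun z => f z ^ (2 - n))
    (fun z => f z ^ (1 - n)) (fun z => f z ^ (-n)) ((3 * m - 1) * β) (3 * m * (m - 1))
    (m * (m - 1) * (m - 2)) (3 - n) β _ df dg
    (fun y hy => by rw [← hk y hy]; exact dh y hy)
    (fun y hy => by
      have := dpow (3 - n) y hy
      rwa [show (3 - n - 1 : ℝ) = 2 - n by ring] at this)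
    (fun y hy => by
      have := dpow (2 - n) y hy
      rw [show (2 - n - 1 : ℝ) = 1 - n by ring] at this
      rwa [show (3 - n - 1 : ℝ) = 2 - n by ring])
    (fun y hy => by
      have := dpow (1 - n) y hy
      rw [show (1 - n - 1 : ℝ) = -n by ring] at this
      rwa [show (3 - n - 2 : ℝ) = 1 - n by ring])
    (dpow (-n) 0 h0) f0 f1 (by simp [f0]) (by simp [f0]) (by simp [f0]) hG
  obtain ⟨k1, k2⟩ := key
  obtain ⟨a, ha⟩ : ∃ a, a = h 0 := ⟨_, rfl⟩
  rw [← ha] at k1 k2 f2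
  have mpos : 0 < m := by linarith
  have a2 : 0 < a ^ 2 := by positivity
  have mlt : m < 1 := by
    by_contra hc
    push Not at hc
    have : 0 < (3 * m - 1) * β := mul_pos (by linarith) βpos
    have : 0 ≤ 3 * m * (m - 1) * a ^ 2 :=
      mul_nonneg (mul_nonneg (by linarith) (by linarith)) a2.le
    linarith
  have k3 : a * β * ((2 * m - 1) * (3 * m - 5)) = 0 := by
    rw [hnm] at k2
    linear_combination (-1 / 2 : ℝ) * k2 + (1 / 2 : ℝ) * a * (3 + 2 * (m - 2)) * k1
  have : (2 * m - 1) * (3 * m - 5) ≠ 0 :=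
    mul_ne_zero (fun hc => hn1 (by linarith)) (by intro hc; linarith)
  exact (mul_ne_zero (mul_ne_zero f2 βpos.ne') this) k3
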